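/- arXiv:math/0510082 — 3 statements merged into one kernel-verified Lean document; each statement's English description precedes it below -/
import Mathlib

section
/- For every element g of the free group F on {S,T}, there exists a natural number n such that the n-th iterate of ψ̄ applied to g lies in the set {1, T, T⁻¹}. -/
noncomputable section

/-- The action of `Equiv.Perm X` on `X → G` by permuting coordinates. -/
def permAut (X G : Type) [Group G] : Equiv.Perm X →* MulAut (X → G) where
  toFun σ :=
  { toFun := fun f => f ∘ ⇑σ⁻¹
    invFun := fun f => f ∘ ⇑σ
    left_inv := fun f => by funext x; simp
    right_inv := fun f => by funext x; simp
    map_mul' := fun f g => rfl }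
  map_one' := by ext f x; simp
  map_mul' := fun σ τ => by
    ext f x
    simp [Function.comp, mul_inv_rev]

/-- The wreath product `G ≀ C₂` with base alphabet `Bool`. -/
abbrev Wr (G : Type) [Group G] := (Bool → G) ⋊[permAut Bool G] Equiv.Perm Bool

/-- `pair g₀ g₁` is the element `⟨g₀, g₁⟩` of the base group. -/
def pair {G : Type} [Group G] (g₀ g₁ : G) : Bool → G := fun x => bif x then g₁ else g₀

/-- The nontrivial element of `Sym({0,1})`. -/
def σswap : Equiv.Perm Bool := Equiv.swap false true

namespace Rabbit

/-- The free group on two generators `S`, `T`. -/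
abbrev F := FreeGroup Bool

def Sg : F := FreeGroup.of false
def Tg : F := FreeGroup.of true

/-- The wreath recursion `Φ(T) = ⟨1, S⁻¹T⁻¹⟩σ`, `Φ(S) = ⟨T, 1⟩`. -/
def Phi : F →* Wr F := FreeGroup.lift fun x =>
  if x then ⟨pair 1 (Sg⁻¹ * Tg⁻¹), σswap⟩ else ⟨pair Tg 1, 1⟩

/-- The section `g|ₓ`. -/
def sec (g : F) (x : Bool) : F := (Phi g).left x

/-- `Φ(g)` is inactive. -/
def inactive (g : F) : Prop := (Phi g).right = 1

open scoped Classical in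
/-- The map `ψ̄`. -/
def psibar (g : F) : F := if inactive g then sec g false else Tg * sec g false

end Rabbit

namespace Rabbit

/-- Words in the letters `S^{±1}` (`false`) and `T^{±1}` (`true`). -/
abbrev Wd := List (Bool × Bool)

/-- Section of a letter. -/
def lsec : Bool × Bool → Bool → Wd
  | (true, true), false => []
  | (true, true), true => [(false, false), (true, false)]
  | (true, false), false => [(true, true), (false, true)]
  | (true, false), true => []
  | (false, b), false => [(true, b)]
  | (false, _), true => []

/-- Section of a word. -/
def wsec : Wd → Bool → Wd
  | [], _ => []
  | c :: w, x => lsec c x ++ wsec w (xor x c.1)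

/-- Activity of a word. -/
def wact : Wd → Bool
  | [] => false
  | c :: w => xor c.1 (wact w)

/-- Reduced section. -/
def rsec (w : Wd) (x : Bool) : Wd := FreeGroup.reduce (wsec w x)

/-- `psibar` on words. -/
def wpsi (w : Wd) : Wd :=
  FreeGroup.reduce (if wact w then (true, true) :: wsec w false else wsec w false)

/-- The nucleus. -/
def nuc : List Wd :=
  [[], [(false, true)], [(false, false)], [(true, true)], [(true, false)],
   [(true, true), (false, true)], [(false, false), (true, false)]]

theorem sec_mul (g h : F) (x : Bool) :
    sec (g * h) x = sec g x * sec h ((Phi g).right⁻¹ x) := by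
  simp only [sec, map_mul, SemidirectProduct.mul_left, Pi.mul_apply]
  rfl

theorem mk_cons (c : Bool × Bool) (w : Wd) :
    (FreeGroup.mk (c :: w) : F) = FreeGroup.mk [c] * FreeGroup.mk w := by
  simp [FreeGroup.mul_mk]

theorem Phi_T : Phi (FreeGroup.mk [(true, true)]) = ⟨pair 1 (Sg⁻¹ * Tg⁻¹), σswap⟩ := by
  simp [Phi, FreeGroup.lift_mk]

theorem Phi_S : Phi (FreeGroup.mk [(false, true)]) = ⟨pair Tg 1, 1⟩ := by
  simp [Phi, FreeGroup.lift_mk]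

theorem Phi_t : Phi (FreeGroup.mk [(true, false)]) =
    (⟨pair 1 (Sg⁻¹ * Tg⁻¹), σswap⟩ : Wr F)⁻¹ := by
  simp [Phi, FreeGroup.lift_mk]

theorem Phi_s : Phi (FreeGroup.mk [(false, false)]) = (⟨pair Tg 1, 1⟩ : Wr F)⁻¹ := by
  simp [Phi, FreeGroup.lift_mk]

theorem swap_inv : σswap⁻¹ = σswap := by simp [σswap]

theorem right_letter (c : Bool × Bool) :
    (Phi (FreeGroup.mk [c])).right = if c.1 then σswap else 1 := by
  rcases c with ⟨_ | _, _ | _⟩ <;> simp [Phi_T, Phi_S, Phi_t, Phi_s, swap_inv]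

theorem swap_apply (x : Bool) : σswap x = !x := by
  cases x <;> simp [σswap]

theorem sec_letter (c : Bool × Bool) (x : Bool) :
    sec (FreeGroup.mk [c]) x = FreeGroup.mk (lsec c x) := by
  rcases c with ⟨_ | _, _ | _⟩
  · rw [sec, Phi_s, SemidirectProduct.inv_left]
    cases x
    · change (Tg)⁻¹ = _
      rfl
    · change (1 : F)⁻¹ = _
      rfl
  · rw [sec, Phi_S]
    cases x <;> rfl
  · rw [sec, Phi_t, SemidirectProduct.inv_left]
    change (pair (1 : F) (Sg⁻¹ * Tg⁻¹))⁻¹ (σswap⁻¹⁻¹ x) = _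
    rw [inv_inv, swap_apply]
    cases x <;> rfl
  · rw [sec, Phi_T]
    cases x <;> rfl

theorem sec_mk (w : Wd) (x : Bool) : sec (FreeGroup.mk w) x = FreeGroup.mk (wsec w x) := by
  induction w generalizing x with
  | nil =>
    simp [← FreeGroup.one_eq_mk, sec, wsec]
  | cons c w ih =>
    rw [mk_cons, sec_mul, sec_letter, right_letter, ih, FreeGroup.mul_mk]
    rcases c with ⟨_ | _, b⟩ <;> cases x <;> simp [wsec, swap_inv, swap_apply]

theorem right_mk (w : Wd) :
    (Phi (FreeGroup.mk w)).right = if wact w then σswap else 1 := by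
  induction w with
  | nil => simp [← FreeGroup.one_eq_mk, wact]
  | cons c w ih =>
    rw [mk_cons, map_mul, SemidirectProduct.mul_right, right_letter, ih]
    rcases c with ⟨_ | _, b⟩ <;> cases h : wact w <;> simp [wact, h, σswap]

theorem inactive_mk (w : Wd) : inactive (FreeGroup.mk w) ↔ wact w = false := by
  rw [inactive, right_mk]
  cases h : wact w
  · simp
  · simp [σswap, Equiv.swap_eq_one_iff]

theorem sec_rsec (w : Wd) (x : Bool) : sec (FreeGroup.mk w) x = FreeGroup.mk (rsec w x) := by
  rw [sec_mk, rsec, FreeGroup.reduce.self]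

theorem psibar_mk (w : Wd) : psibar (FreeGroup.mk w) = FreeGroup.mk (wpsi w) := by
  rw [wpsi, FreeGroup.reduce.self, psibar, inactive_mk, sec_mk]
  cases h : wact w
  · simp
  · simp [Tg, FreeGroup.of, FreeGroup.mul_mk]

theorem psibar_iter_mk (n : ℕ) (w : Wd) :
    psibar^[n] (FreeGroup.mk w) = FreeGroup.mk (wpsi^[n] w) := by
  induction n generalizing w with
  | zero => rfl
  | succ n ih => rw [Function.iterate_succ_apply, psibar_mk, ih, Function.iterate_succ_apply]

/-- Membership in the nucleus. -/
def InN (g : F) : Prop := ∃ w ∈ nuc, g = FreeGroup.mk w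

/-- All sections at level `k` are in the nucleus. -/
def Lev : ℕ → F → Prop
  | 0, g => InN g
  | k + 1, g => ∀ x, Lev k (sec g x)

theorem nuc_closed : ∀ w ∈ nuc, ∀ x, rsec w x ∈ nuc := by decide

theorem nuc_contract : ∀ w ∈ nuc, ∀ v ∈ nuc, ∀ x y, rsec (rsec (w ++ v) x) y ∈ nuc := by
  decide +kernel

theorem final_check : ∀ w ∈ nuc, ∀ b : Bool, ∃ k ∈ List.range 4,
    wpsi^[k] (if b then (true, true) :: w else w) ∈
      ([[], [(true, true)], [(true, false)]] : List Wd) := by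
  decide +kernel

theorem InN.sec {g : F} (h : InN g) (x : Bool) : InN (sec g x) := by
  obtain ⟨w, hw, rfl⟩ := h
  exact ⟨rsec w x, nuc_closed w hw x, sec_rsec w x⟩

theorem Lev.mul {k : ℕ} {a h : F} (ha : InN a) (hh : Lev k h) : Lev (k + 2) (a * h) := by
  induction k generalizing a h with
  | zero =>
    obtain ⟨w, hw, rfl⟩ := ha
    obtain ⟨v, hv, rfl⟩ := hh
    intro x y
    rw [FreeGroup.mul_mk, sec_rsec, sec_rsec]
    exact ⟨_, nuc_contract w hw v hv x y, rfl⟩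
  | succ k ih =>
    intro x
    rw [sec_mul]
    exact ih (ha.sec x) (hh _)

theorem exists_lev (w : Wd) : ∃ k, Lev k (FreeGroup.mk w) := by
  induction w with
  | nil => exact ⟨0, [], by decide, rfl⟩
  | cons c w ih =>
    obtain ⟨k, hk⟩ := ih
    refine ⟨k + 2, ?_⟩
    rw [mk_cons]
    refine Lev.mul ⟨[c], ?_, rfl⟩ hk
    revert c
    decide

theorem psibar_cases (g : F) : psibar g = sec g false ∨ psibar g = Tg * sec g false := by
  unfold psibar
  split_ifs <;> simp

theorem sec_Tg_false : sec Tg false = 1 := by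
  exact sec_letter (true, true) false

theorem psibar_acc (k : ℕ) (c h : F) (hc : c = 1 ∨ c = Tg) (hh : Lev k h) :
    ∃ c' h' : F, (c' = 1 ∨ c' = Tg) ∧ InN h' ∧ psibar^[k] (c * h) = c' * h' := by
  induction k generalizing c h with
  | zero => exact ⟨c, h, hc, hh, rfl⟩
  | succ k ih =>
    have hc1 : sec c false = 1 := by
      rcases hc with rfl | rfl
      · simp [sec]
      · exact sec_Tg_false
    rw [Function.iterate_succ_apply]
    rcases psibar_cases (c * h) with e | e <;> rw [e, sec_mul, hc1, one_mul]
    · simpa using ih 1 _ (Or.inl rfl) (hh _)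
    · exact ih Tg _ (Or.inr rfl) (hh _)

theorem final_mk (w : Wd) (hw : w ∈ nuc) (b : Bool) : ∃ n : ℕ,
    psibar^[n] (FreeGroup.mk (if b then (true, true) :: w else w)) ∈ ({1, Tg, Tg⁻¹} : Set F) := by
  obtain ⟨n, -, hn⟩ := final_check w hw b
  refine ⟨n, ?_⟩
  rw [psibar_iter_mk]
  simp only [List.mem_cons, List.not_mem_nil, or_false] at hn
  rcases hn with e | e | e <;> rw [e]
  · exact Or.inl rfl
  · exact Or.inr (Or.inl rfl)
  · exact Or.inr (Or.inr rfl)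

end Rabbit

theorem stmt0 : ∀ g : Rabbit.F, ∃ n : ℕ,
    Rabbit.psibar^[n] g ∈ ({1, Rabbit.Tg, Rabbit.Tg⁻¹} : Set Rabbit.F) := by
  intro g
  obtain ⟨w, rfl⟩ : ∃ w, g = FreeGroup.mk w := ⟨g.toWord, FreeGroup.mk_toWord.symm⟩
  obtain ⟨k, hk⟩ := Rabbit.exists_lev w
  obtain ⟨c, h, hc, ⟨v, hv, rfl⟩, e⟩ := Rabbit.psibar_acc k 1 _ (Or.inl rfl) hk
  rw [one_mul] at e
  have key : ∃ n : ℕ, Rabbit.psibar^[n] (c * FreeGroup.mk v) ∈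
      ({1, Rabbit.Tg, Rabbit.Tg⁻¹} : Set Rabbit.F) := by
    rcases hc with rfl | rfl
    · simpa using Rabbit.final_mk v hv false
    · have := Rabbit.final_mk v hv true
      rw [if_pos rfl, Rabbit.mk_cons] at this
      exact this
  obtain ⟨n, hn⟩ := key
  refine ⟨n + k, ?_⟩
  rw [Function.iterate_add_apply, e]
  exact hn
end
end

section
/- Let g₂ = 60·Σ_{ω ∈ ℤ[i], ω ≠ 0} ω⁻⁴. For every complex number z such that z ∉ ℤ[i], (1+i)z ∉ ℤ[i], and ℘(z) ≠ 0, one has ℘((1+i)z) = −(i/8)·(4℘(z)² − g₂)/℘(z). -/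
noncomputable section

open Complex

/-- The lattice `ℤ[i] ⊂ ℂ` of Gaussian integers. -/
def Zi : Set ℂ := Set.range (⇑GaussianInt.toComplex)

/-- The Weierstrass function of the lattice `ℤ[i]`:
`℘(z) = 1/z² + Σ_{ω ∈ ℤ[i], ω ≠ 0} [1/(z+ω)² − 1/ω²]`. -/
def wp (z : ℂ) : ℂ :=
  1 / z ^ 2 + ∑' ω : {w : ℂ // w ∈ Zi ∧ w ≠ 0}, (1 / (z + (ω : ℂ)) ^ 2 - 1 / (ω : ℂ) ^ 2)

/-- The Eisenstein series coefficient `g₂ = 60·Σ_{ω ∈ ℤ[i], ω ≠ 0} ω⁻⁴`. -/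
def g2 : ℂ := 60 * ∑' ω : {w : ℂ // w ∈ Zi ∧ w ≠ 0}, ((ω : ℂ) ^ 4)⁻¹

/-- The period pair `(1, i)`. -/
def LG : PeriodPair where
  ω₁ := 1
  ω₂ := I
  indep := by
    rw [LinearIndependent.pair_iff]
    intro s t h
    have h1 := congrArg Complex.re h
    have h2 := congrArg Complex.im h
    simp at h1 h2
    exact ⟨h1, h2⟩

lemma LG_mem {x : ℂ} : x ∈ LG.lattice ↔ ∃ m n : ℤ, (m : ℂ) + n * I = x := by
  rw [PeriodPair.mem_lattice]
  simp [LG]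

lemma LG_mem_iff (x : ℂ) : x ∈ LG.lattice ↔ x ∈ Zi := by
  rw [LG_mem]
  constructor
  · rintro ⟨m, n, rfl⟩
    exact ⟨⟨m, n⟩, by simp [GaussianInt.toComplex_def]⟩
  · rintro ⟨a, rfl⟩
    exact ⟨a.re, a.im, by simp [GaussianInt.toComplex_def]⟩

lemma LG_I_mul {x : ℂ} (h : x ∈ LG.lattice) : I * x ∈ LG.lattice := by
  rw [LG_mem] at *
  obtain ⟨m, n, rfl⟩ := h
  refine ⟨-n, m, ?_⟩
  push_cast
  linear_combination -(n : ℂ) * I_sq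

lemma LG_theta_mul {x : ℂ} (h : x ∈ LG.lattice) : (1 + I) * x ∈ LG.lattice := by
  rw [add_mul, one_mul]
  exact add_mem h (LG_I_mul h)

/-- Weierstrass function of the Gaussian lattice. -/
abbrev PG : ℂ → ℂ := LG.weierstrassP

/-- Weierstrass function of the Gaussian lattice without the pole at zero. -/
abbrev EG : ℂ → ℂ := LG.weierstrassPExcept 0

lemma PG_eq (z : ℂ) : PG z = EG z + 1 / z ^ 2 := by
  have := LG.weierstrassPExcept_add 0 z
  simp at this
  simp [PG, EG, this]

/-- Negated inclusion of nonzero lattice points. -/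
def incl (ω : {w : ℂ // w ∈ Zi ∧ w ≠ 0}) : LG.lattice :=
  ⟨-ω.1, neg_mem ((LG_mem_iff _).2 ω.2.1)⟩

lemma incl_inj : Function.Injective incl := by
  intro a b h
  have := congrArg Subtype.val h
  simp only [incl, neg_inj] at this
  exact Subtype.ext this

lemma incl_range {l : LG.lattice} (h : l ≠ 0) : l ∈ Set.range incl := by
  refine ⟨⟨-l.1, (LG_mem_iff _).1 (neg_mem l.2), by simpa using h⟩, ?_⟩
  ext; simp [incl]

lemma wp_eq (z : ℂ) : wp z = PG z := by
  rw [PG_eq, wp, add_comm]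
  congr 1
  rw [EG, PeriodPair.weierstrassPExcept, ← incl_inj.tsum_eq]
  · congr 1
    ext ω
    have : ω.1 ≠ 0 := ω.2.2
    simp [incl, this]
  · intro l hl
    apply incl_range
    rintro rfl
    simp at hl

lemma g2_eq : g2 = 60 * LG.G 4 := by
  rw [g2, PeriodPair.G, ← incl_inj.tsum_eq]
  · congr 2
    ext ω
    simp [incl, Even.neg_pow (show Even 4 by decide)]
  · intro l hl
    apply incl_range
    rintro rfl
    simp at hl

/-- Multiplication by `i` on the lattice. -/
def mulI : LG.lattice ≃ LG.lattice where
  toFun l := ⟨I * l.1, LG_I_mul l.2⟩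
  invFun l := ⟨-(I * l.1), neg_mem (LG_I_mul l.2)⟩
  left_inv l := by ext; simp [← mul_assoc]
  right_inv l := by ext; simp [← mul_assoc]

lemma PG_I_mul (z : ℂ) : PG (I * z) = - PG z := by
  simp only [PG, PeriodPair.weierstrassP]
  rw [← mulI.tsum_eq, ← tsum_neg]
  congr 1
  ext l
  simp only [mulI, Equiv.coe_fn_mk, ← mul_sub, mul_pow, I_sq]
  simp [neg_add_eq_sub, div_eq_mul_inv]

/-- The point `(1+i)/2`. -/
def z0 : ℂ := (1 + I) / 2

lemma PG_z0 : PG z0 = 0 := by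
  have h := PG_I_mul z0
  have h2 : I * z0 = z0 - ((⟨1, LG_mem.2 ⟨1, 0, by simp⟩⟩ : LG.lattice) : ℂ) := by
    simp only [z0]
    linear_combination (1 / 2) * I_sq
  rw [h2, PG, PeriodPair.weierstrassP_sub_coe] at h
  exact CharZero.eq_neg_self_iff.1 h

lemma PG_add {l : ℂ} (hl : l ∈ LG.lattice) (z : ℂ) : PG (z + l) = PG z :=
  LG.weierstrassP_add_coe z ⟨l, hl⟩

lemma theta_z0 : (1 + I) * z0 = I := by
  simp only [z0]; linear_combination (1 / 2) * I_sq

lemma I_mem : I ∈ LG.lattice := LG_mem.2 ⟨0, 1, by simp⟩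

lemma two_z0_mem : z0 + z0 ∈ LG.lattice := LG_mem.2 ⟨1, 1, by simp [z0]⟩

lemma z0_notMem : z0 ∉ LG.lattice := by
  intro h
  obtain ⟨m, n, h⟩ := LG_mem.1 h
  have := congrArg Complex.re h
  simp [z0] at this
  have h3 : ((2 * m : ℤ) : ℝ) = (1 : ℤ) := by push_cast; linarith
  have h4 := Int.cast_injective h3
  omega

/-- points of the big lattice are lattice points or translates of `z0`. -/
lemma big_mem {x : ℂ} (h : (1 + I) * x ∈ LG.lattice) :
    x ∈ LG.lattice ∨ x - z0 ∈ LG.lattice := by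
  obtain ⟨m, n, h⟩ := LG_mem.1 h
  have hx : x = (1 - I) * (m + n * I) / 2 := by
    linear_combination (-(1 - I) / 2) * h + x / 2 * I_sq
  rcases Int.even_or_odd' (m + n) with ⟨k, hk | hk⟩
  · left
    have hk' : (m : ℂ) + n = 2 * k := by exact_mod_cast hk
    refine LG_mem.2 ⟨k, k - m, ?_⟩
    rw [hx]; push_cast
    linear_combination (-(1 + I) / 2) * hk' + (n : ℂ) / 2 * I_sq
  · right
    have hk' : (m : ℂ) + n = 2 * k + 1 := by exact_mod_cast hk
    refine LG_mem.2 ⟨k, k - m, ?_⟩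
    rw [hx, z0]; push_cast
    linear_combination (-(1 + I) / 2) * hk' + (n : ℂ) / 2 * I_sq

lemma big_mem_z0 {x : ℂ} :
    (1 + I) * (x + z0) ∈ LG.lattice ↔ (1 + I) * x ∈ LG.lattice := by
  rw [mul_add, theta_z0]
  exact LG.lattice.toAddSubgroup.add_mem_cancel_right I_mem

lemma big_mem_L {x l : ℂ} (hl : l ∈ LG.lattice) :
    (1 + I) * (x + l) ∈ LG.lattice ↔ (1 + I) * x ∈ LG.lattice := by
  rw [mul_add]
  exact LG.lattice.toAddSubgroup.add_mem_cancel_right (LG_theta_mul hl)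

lemma isOpen_big : IsOpen {x : ℂ | (1 + I) * x ∉ LG.lattice} :=
  LG.isClosed_lattice.isOpen_compl.preimage (by fun_prop : Continuous fun x : ℂ => (1 + I) * x)

lemma liouville (f : ℂ → ℂ) (hL : ∀ l ∈ LG.lattice, ∀ z, f (z + l) = f z)
    (hz : ∀ z, f (z + z0) = f z) (h0 : AnalyticAt ℂ f 0)
    (hd : ∀ x, (1 + I) * x ∉ LG.lattice → DifferentiableAt ℂ f x) (z : ℂ) : f z = f 0 := by
  have key : ∀ p, (∀ z, f (z + p) = f z) → DifferentiableAt ℂ f p := by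
    intro p hp
    have h1 : DifferentiableAt ℂ f (p - p) := by simpa using h0.differentiableAt
    have h2 : DifferentiableAt ℂ (fun z => f (z - p)) p :=
      DifferentiableAt.comp (f := fun z => z - p) p h1 (by fun_prop)
    convert h2 using 1
    ext z
    rw [← hp (z - p), sub_add_cancel]
  have hdiff : Differentiable ℂ f := by
    intro x
    by_cases hx : (1 + I) * x ∈ LG.lattice
    · apply key
      intro z
      rcases big_mem hx with h | h
      · exact hL x h z
      · rw [show z + x = z + z0 + (x - z0) by ring, hL _ h, hz]
    · exact hd x hx
  exact hdiff.apply_eq_apply_of_bounded (IsZLattice.isCompact_range_of_periodic LG.lattice _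
    hdiff.continuous fun z w hw ↦ hL w hw z).isBounded z 0

lemma EG_factor : ∃ r : ℂ → ℂ, AnalyticAt ℂ r 0 ∧ r 0 = 3 * LG.G 4 ∧ ∀ z, EG z = z ^ 2 * r z := by
  have h := LG.hasFPowerSeriesAt_weierstrassPExcept 0
  have h1 := h.has_fpower_series_dslope_fslope
  have h2 := h1.has_fpower_series_dslope_fslope
  refine ⟨_, h2.analyticAt, ?_, ?_⟩
  · rw [← h2.coeff_zero 1]
    change FormalMultilinearSeries.coeff _ 0 = _
    rw [FormalMultilinearSeries.coeff_fslope, FormalMultilinearSeries.coeff_fslope,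
      FormalMultilinearSeries.coeff_ofScalars]
    simp
    norm_num
  · intro z
    have e1 : dslope (LG.weierstrassPExcept 0) 0 0 = 0 := by
      rw [← h1.coeff_zero 1]
      change FormalMultilinearSeries.coeff _ 0 = _
      rw [FormalMultilinearSeries.coeff_fslope, FormalMultilinearSeries.coeff_ofScalars]
      simp [LG.G_eq_zero_of_odd 3 (by decide)]
    have a1 := sub_smul_dslope (LG.weierstrassPExcept 0) 0 z
    have a2 := sub_smul_dslope (dslope (LG.weierstrassPExcept 0) 0) 0 z
    rw [e1] at a2
    simp only [PeriodPair.weierstrassPExcept_zero, sub_zero, smul_eq_mul] at a1 a2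
    rw [EG, ← a1, ← a2]
    ring

lemma diff_PG {x : ℂ} (h : x ∉ LG.lattice) : DifferentiableAt ℂ PG x :=
  (LG.analyticOnNhd_weierstrassP x h).differentiableAt

lemma notMem_of_big {x : ℂ} (h : (1 + I) * x ∉ LG.lattice) : x ∉ LG.lattice :=
  fun hx => h (LG_theta_mul hx)

lemma theta_ne : (1 + I : ℂ) ≠ 0 := by
  intro h
  simpa using congrArg Complex.re h

lemma big_nhds : ∀ᶠ z in nhds (0 : ℂ), z ≠ 0 → (1 + I) * z ∉ LG.lattice := by
  have h1 := LG.compl_lattice_sdiff_singleton_mem_nhds 0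
  have hc : Filter.Tendsto (fun z : ℂ => (1 + I) * z) (nhds 0) (nhds 0) := by
    have : Continuous (fun z : ℂ => (1 + I) * z) := by fun_prop
    simpa using this.tendsto 0
  filter_upwards [hc h1] with z hz hz0 hm
  apply hz
  refine ⟨hm, ?_⟩
  simp only [Set.mem_singleton_iff, mul_eq_zero, not_or]
  exact ⟨theta_ne, hz0⟩

lemma zero_big : (1 + I) * (0 : ℂ) ∈ LG.lattice := by simp

lemma analyticAt_EG : AnalyticAt ℂ EG 0 := LG.analyticAt_weierstrassPExcept 0

lemma analyticAt_shift : AnalyticAt ℂ (fun z => PG (z + z0)) 0 := by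
  have h := LG.analyticOnNhd_weierstrassP z0 z0_notMem
  exact AnalyticAt.fun_comp (g := PG) (f := fun z => z + z0) (by simpa using h) (by fun_prop)

lemma analyticAt_scale {f : ℂ → ℂ} (hf : AnalyticAt ℂ f 0) :
    AnalyticAt ℂ (fun z => f ((1 + I) * z)) 0 :=
  AnalyticAt.fun_comp (g := f) (f := fun z => (1 + I) * z) (by simpa using hf) (by fun_prop)

lemma PG_z0_z0 (z : ℂ) : PG (z + z0 + z0) = PG z := by
  rw [add_assoc, PG_add two_z0_mem]

/-- Extending a function on the complement of the big lattice by a constant. -/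
lemma liouville' (f : ℂ → ℂ) (c : ℂ) (g : ℂ → ℂ)
    (hL : ∀ l ∈ LG.lattice, ∀ z, f (z + l) = f z)
    (hz : ∀ z, f (z + z0) = f z) (hg : AnalyticAt ℂ g 0) (hgc : g 0 = c)
    (hfg : ∀ᶠ z in nhds (0 : ℂ), z ≠ 0 → f z = g z)
    (hd : ∀ x, (1 + I) * x ∉ LG.lattice → DifferentiableAt ℂ f x) (z : ℂ)
    (h : (1 + I) * z ∉ LG.lattice) : f z = c := by
  classical
  have := liouville (fun z => if (1 + I) * z ∈ LG.lattice then c else f z) ?_ ?_ ?_ ?_ z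
  · simpa [h] using this
  · intro l hl z
    simp only [big_mem_L hl, hL l hl]
  · intro z
    simp only [big_mem_z0, hz]
  · refine hg.congr ?_
    filter_upwards [hfg, big_nhds] with z h1 h2
    by_cases h3 : z = 0
    · simp [h3, hgc]
    · rw [if_neg (h2 h3), h1 h3]
  · intro x hx
    refine (hd x hx).congr_of_eventuallyEq ?_
    filter_upwards [isOpen_big.mem_nhds hx] with y hy
    exact if_neg hy

lemma diff_scale {x : ℂ} (h : (1 + I) * x ∉ LG.lattice) :
    DifferentiableAt ℂ (fun z => PG ((1 + I) * z)) x :=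
  DifferentiableAt.comp (f := fun z => (1 + I) * z) x (diff_PG h) (by fun_prop)

lemma diff_shift {x : ℂ} (h : (1 + I) * x ∉ LG.lattice) :
    DifferentiableAt ℂ (fun z => PG (z + z0)) x :=
  DifferentiableAt.comp (f := fun z => z + z0) x
    (diff_PG (notMem_of_big (big_mem_z0.not.2 h))) (by fun_prop)

lemma inv_theta_sq (z : ℂ) : 1 / ((1 + I) * z) ^ 2 = -(I / 2) * (1 / z ^ 2) := by
  have h : (1 + I) ^ 2 = 2 * I := by linear_combination I_sq
  have h2 : (2 * I)⁻¹ = -(I / 2) := by simp; ring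
  rw [mul_pow, h, one_div, mul_inv, h2, one_div]

lemma sum_formula (z : ℂ) (hz : (1 + I) * z ∉ LG.lattice) :
    PG ((1 + I) * z) + (I / 2) * (PG z + PG (z + z0)) = 0 := by
  refine liouville' (fun z => PG ((1 + I) * z) + (I / 2) * (PG z + PG (z + z0))) 0
    (fun z => EG ((1 + I) * z) + (I / 2) * (EG z + PG (z + z0))) ?_ ?_ ?_ ?_ ?_ ?_ z hz
  · intro l hl z
    rw [mul_add, PG_add (LG_theta_mul hl), PG_add hl, add_right_comm, PG_add hl]
  · intro z
    rw [mul_add, theta_z0, PG_add I_mem, PG_z0_z0, add_comm (PG (z + z0))]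
  · have h1 := analyticAt_scale analyticAt_EG
    have h2 := analyticAt_EG
    have h3 := analyticAt_shift
    exact h1.add (analyticAt_const.mul (h2.add h3))
  · simp [PG_z0]
  · refine Filter.Eventually.of_forall fun z _ => ?_
    rw [PG_eq z, PG_eq ((1 + I) * z), inv_theta_sq]
    ring
  · intro x hx
    exact (diff_scale hx).add ((differentiableAt_const _).mul
      ((diff_PG (notMem_of_big hx)).add (diff_shift hx)))

lemma prod_formula (z : ℂ) (hz : (1 + I) * z ∉ LG.lattice) :
    PG z * PG (z + z0) = -(g2 / 4) := by
  obtain ⟨r, hr, hr0, hrE⟩ := EG_factor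
  refine liouville' (fun z => PG z * PG (z + z0)) _
    (fun z => (z ^ 4 * r z + 1) * (-4 * r ((1 + I) * z) - r z)) ?_ ?_ ?_ ?_ ?_ ?_ z hz
  · intro l hl z
    rw [PG_add hl, add_right_comm, PG_add hl]
  · intro z
    rw [PG_z0_z0, mul_comm]
  · have h1 := analyticAt_scale hr
    exact (((analyticAt_id.pow 4).mul hr).add analyticAt_const).mul
      ((analyticAt_const.mul h1).sub hr)
  · simp [hr0, g2_eq]
    ring
  · filter_upwards [big_nhds] with z h1 h2
    have h3 := sum_formula z (h1 h2)
    rw [PG_eq ((1 + I) * z), inv_theta_sq, PG_eq z, hrE, hrE] at h3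
    have h4 : PG (z + z0) = z ^ 2 * (-4 * r ((1 + I) * z) - r z) := by
      linear_combination (-2 * I) * h3 + (PG (z + z0) + z ^ 2 * r z + 4 * z ^ 2 * r ((1 + I) * z)
        + 2 * I * z ^ 2 * r ((1 + I) * z)) * I_sq
    rw [h4, PG_eq, hrE]
    field_simp
  · intro x hx
    exact (diff_PG (notMem_of_big hx)).mul (diff_shift hx)

theorem stmt10 : ∀ z : ℂ, z ∉ Zi → (1 + I) * z ∉ Zi → wp z ≠ 0 →
    wp ((1 + I) * z) = -(I / 8) * (4 * wp z ^ 2 - g2) / wp z := by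
  intro z _ h2 h3
  rw [← LG_mem_iff] at h2
  rw [wp_eq] at h3
  rw [wp_eq, wp_eq, eq_div_iff h3]
  linear_combination PG z * sum_formula z h2 - (I / 2) * prod_formula z h2
end
end

section
/- E_∞ equals the normal closure N in F of the set {a², (ab)⁴} ∪ {[b⁴, w⁻¹b⁴w] : w ∈ F}, where [x,y] = x⁻¹y⁻¹xy. -/
noncomputable section

namespace Obstr

/-- The free group on two generators `a`, `b`. -/
abbrev F := FreeGroup Bool

def ag : F := FreeGroup.of false
def bg : F := FreeGroup.of true

/-- The wreath recursion `Φ(a) = ⟨1,1⟩σ`, `Φ(b) = ⟨b⁻¹a⁻¹, b⟩`. -/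
def Phi : F →* Wr F := FreeGroup.lift fun x =>
  if x then ⟨pair (bg⁻¹ * ag⁻¹) bg, 1⟩ else ⟨pair 1 1, σswap⟩

/-- The section `g|ₓ`. -/
def sec (g : F) (x : Bool) : F := (Phi g).left x

/-- `Φ(g)` is inactive. -/
def inactive (g : F) : Prop := (Phi g).right = 1

/-- The commutator `[x,y] = x⁻¹y⁻¹xy`. -/
def comm (x y : F) : F := x⁻¹ * y⁻¹ * x * y

/-- The relators `{a², (ab)⁴} ∪ {[b⁴, w⁻¹b⁴w] : w ∈ F}`. -/
def rels : Set F :=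
  {ag ^ 2, (ag * bg) ^ 4} ∪ {x : F | ∃ w : F, x = comm (bg ^ 4) (w⁻¹ * bg ^ 4 * w)}

/-- `N`, the normal closure of the relators. -/
def NN : Subgroup F := Subgroup.normalClosure rels

instance : NN.Normal := Subgroup.normalClosure_normal

/-- The quotient group `Ĝ = F/N`. -/
abbrev Ghat := F ⧸ NN

/-- The quotient homomorphism `π : F → Ĝ`. -/
def pi : F →* Ghat := QuotientGroup.mk' NN

end Obstr

namespace Obstr

/-- The subgroups `Eₙ` (as subsets): `E₀ = {1}`,
`Eₙ₊₁ = {g : Φ(g) inactive, g|₀ ∈ Eₙ, g|₁ ∈ Eₙ}`. -/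
def E : ℕ → Set F
  | 0 => {1}
  | n + 1 => {g : F | inactive g ∧ sec g false ∈ E n ∧ sec g true ∈ E n}

end Obstr

namespace Obstr

lemma perm_cases (s : Equiv.Perm Bool) : s = 1 ∨ s = σswap := by
  revert s; unfold σswap; decide

lemma swap_ne : σswap ≠ 1 := by unfold σswap; decide
lemma swap_mul : σswap * σswap = 1 := by unfold σswap; decide
lemma swap_inv : σswap⁻¹ = σswap := by unfold σswap; decide
lemma swap_f : σswap false = true := by unfold σswap; decide
lemma swap_t : σswap true = false := by unfold σswap; decide

/-- `Φ(g)` is active. -/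
def active (g : F) : Prop := (Phi g).right = σswap

lemma act_cases (g : F) : inactive g ∨ active g := perm_cases _

lemma not_both {g : F} (h : inactive g) (h' : active g) : False :=
  swap_ne (h'.symm.trans h)

lemma permAut_apply {X G : Type} [Group G] (s : Equiv.Perm X) (f : X → G) (x : X) :
    permAut X G s f x = f (s⁻¹ x) := rfl

lemma sec_mul (g h : F) (x : Bool) : sec (g * h) x = sec g x * sec h ((Phi g).right⁻¹ x) := by
  simp [sec, permAut_apply]

lemma sec_one (x : Bool) : sec 1 x = 1 := by simp [sec]
lemma inactive_one : inactive 1 := by simp [inactive]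

lemma sec_mul_i {g : F} (hg : inactive g) (h : F) (x : Bool) :
    sec (g * h) x = sec g x * sec h x := by
  rw [sec_mul, show (Phi g).right = 1 from hg]; rfl

lemma sec_mul_af {g : F} (hg : active g) (h : F) :
    sec (g * h) false = sec g false * sec h true := by
  rw [sec_mul, show (Phi g).right = σswap from hg, swap_inv, swap_f]

lemma sec_mul_at {g : F} (hg : active g) (h : F) :
    sec (g * h) true = sec g true * sec h false := by
  rw [sec_mul, show (Phi g).right = σswap from hg, swap_inv, swap_t]

lemma ii {g h : F} (hg : inactive g) (hh : inactive h) : inactive (g * h) := by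
  unfold inactive at *; simp [hg, hh]
lemma ia {g h : F} (hg : inactive g) (hh : active h) : active (g * h) := by
  unfold inactive active at *; simp [hg, hh]
lemma ai {g h : F} (hg : active g) (hh : inactive h) : active (g * h) := by
  unfold inactive active at *; simp [hg, hh]
lemma aa {g h : F} (hg : active g) (hh : active h) : inactive (g * h) := by
  unfold inactive active at *; simp [hg, hh, swap_mul]
lemma inv_i {g : F} (hg : inactive g) : inactive g⁻¹ := by
  unfold inactive at *; simp [hg]
lemma inv_a {g : F} (hg : active g) : active g⁻¹ := by
  unfold active at *; simp [hg, swap_inv]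

lemma sec_inv_i {g : F} (hg : inactive g) (x : Bool) : sec g⁻¹ x = (sec g x)⁻¹ := by
  have := sec_mul_i hg g⁻¹ x
  rw [mul_inv_cancel, sec_one] at this
  exact (inv_eq_of_mul_eq_one_right this.symm).symm
lemma sec_inv_af {g : F} (hg : active g) : sec g⁻¹ false = (sec g true)⁻¹ := by
  have := sec_mul_at hg g⁻¹
  rw [mul_inv_cancel, sec_one] at this
  exact (inv_eq_of_mul_eq_one_right this.symm).symm
lemma sec_inv_at {g : F} (hg : active g) : sec g⁻¹ true = (sec g false)⁻¹ := by
  have := sec_mul_af hg g⁻¹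
  rw [mul_inv_cancel, sec_one] at this
  exact (inv_eq_of_mul_eq_one_right this.symm).symm

lemma Phi_a : Phi ag = ⟨pair 1 1, σswap⟩ := by simp [Phi, ag]
lemma Phi_b : Phi bg = ⟨pair (bg⁻¹ * ag⁻¹) bg, 1⟩ := by simp [Phi, bg]
lemma act_a : active ag := by simp [active, Phi_a]
lemma ina_b : inactive bg := by simp [inactive, Phi_b]
lemma sec_a (x : Bool) : sec ag x = 1 := by cases x <;> simp [sec, Phi_a, pair]
lemma sec_bf : sec bg false = bg⁻¹ * ag⁻¹ := by simp [sec, Phi_b, pair]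
lemma sec_bt : sec bg true = bg := by simp [sec, Phi_b, pair]

/-- inactive elements -/
def HH : Subgroup F where
  carrier := {g | inactive g}
  mul_mem' := ii
  one_mem' := inactive_one
  inv_mem' := inv_i

/-- section as a hom on inactive elements -/
def secH (x : Bool) : HH →* F where
  toFun g := sec g.1 x
  map_one' := sec_one x
  map_mul' g h := sec_mul_i g.2 _ _

lemma pow_i {g : F} (hg : inactive g) (n : ℕ) : inactive (g ^ n) := HH.pow_mem hg n
lemma zpow_i {g : F} (hg : inactive g) (n : ℤ) : inactive (g ^ n) := HH.zpow_mem hg n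
lemma sec_pow {g : F} (hg : inactive g) (n : ℕ) (x : Bool) : sec (g ^ n) x = sec g x ^ n :=
  map_pow (secH x) ⟨g, hg⟩ n
lemma sec_zpow {g : F} (hg : inactive g) (n : ℤ) (x : Bool) : sec (g ^ n) x = sec g x ^ n :=
  map_zpow (secH x) ⟨g, hg⟩ n

/-- elements all of whose sections lie in `H`. -/
def Up (H : Subgroup F) : Subgroup F where
  carrier := {g | inactive g ∧ sec g false ∈ H ∧ sec g true ∈ H}
  mul_mem' := by
    rintro g h ⟨h1, h2, h3⟩ ⟨k1, k2, k3⟩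
    refine ⟨ii h1 k1, ?_, ?_⟩ <;> rw [sec_mul_i h1]
    · exact H.mul_mem h2 k2
    · exact H.mul_mem h3 k3
  one_mem' := ⟨inactive_one, by rw [sec_one]; exact H.one_mem, by rw [sec_one]; exact H.one_mem⟩
  inv_mem' := by
    rintro g ⟨h1, h2, h3⟩
    refine ⟨inv_i h1, ?_, ?_⟩ <;> rw [sec_inv_i h1]
    · exact H.inv_mem h2
    · exact H.inv_mem h3

lemma Up_normal (H : Subgroup F) (hH : H.Normal) : (Up H).Normal := by
  constructor
  rintro g ⟨h1, h2, h3⟩ k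
  rcases act_cases k with hk | hk
  · refine ⟨ii (ii hk h1) (inv_i hk), ?_, ?_⟩ <;>
      rw [sec_mul_i (ii hk h1), sec_mul_i hk, sec_inv_i hk]
    · exact hH.conj_mem _ h2 _
    · exact hH.conj_mem _ h3 _
  · refine ⟨aa (ai hk h1) (inv_a hk), ?_, ?_⟩
    · rw [sec_mul_af (ai hk h1), sec_mul_af hk, sec_inv_at hk]
      exact hH.conj_mem _ h3 _
    · rw [sec_mul_at (ai hk h1), sec_mul_at hk, sec_inv_af hk]
      exact hH.conj_mem _ h2 _

/-- `Eₙ` as a subgroup. -/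
def Es : ℕ → Subgroup F
  | 0 => ⊥
  | n + 1 => Up (Es n)

lemma Es_normal (n : ℕ) : (Es n).Normal := by
  induction n with
  | zero => exact Subgroup.normal_bot
  | succ n ih => exact Up_normal _ ih

lemma Es_coe (n : ℕ) : (Es n : Set F) = E n := by
  induction n with
  | zero => simp [Es, E]
  | succ n ih =>
    ext g
    simp only [E, ← ih]
    rfl

lemma Es_mono : Monotone Es := by
  apply monotone_nat_of_le_succ
  intro n
  induction n with
  | zero => exact bot_le
  | succ n ih => exact fun g hg => ⟨hg.1, ih hg.2.1, ih hg.2.2⟩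

/-- The union of the `Eₙ`. -/
def Ei : Subgroup F := ⨆ n, Es n

lemma mem_Ei {g : F} : g ∈ Ei ↔ ∃ n, g ∈ Es n :=
  Subgroup.mem_iSup_of_directed Es_mono.directed_le

instance Ei_normal : Ei.Normal := by
  constructor
  intro g hg k
  obtain ⟨n, hn⟩ := mem_Ei.1 hg
  exact mem_Ei.2 ⟨n, (Es_normal n).conj_mem _ hn _⟩

lemma Ei_up {g : F} (h : inactive g) (h0 : sec g false ∈ Ei) (h1 : sec g true ∈ Ei) : g ∈ Ei := by
  obtain ⟨n, hn⟩ := mem_Ei.1 h0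
  obtain ⟨m, hm⟩ := mem_Ei.1 h1
  exact mem_Ei.2 ⟨max n m + 1, h, Es_mono (le_max_left _ _) hn, Es_mono (le_max_right _ _) hm⟩

lemma Ei_coe : (⋃ n : ℕ, E n) = (Ei : Set F) := by
  ext g
  simp [mem_Ei, ← Es_coe]

/-! ### `N ⊆ E_∞` -/

lemma a2_mem : ag ^ 2 ∈ Ei := by
  rw [pow_two]
  refine Ei_up (aa act_a act_a) ?_ ?_
  · rw [sec_mul_af act_a, sec_a, sec_a]; simp [Ei.one_mem]
  · rw [sec_mul_at act_a, sec_a, sec_a]; simp [Ei.one_mem]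

lemma act_ab : active (ag * bg) := ai act_a ina_b
lemma sec_abf : sec (ag * bg) false = bg := by
  rw [sec_mul_af act_a, sec_a, sec_bt, one_mul]
lemma sec_abt : sec (ag * bg) true = bg⁻¹ * ag⁻¹ := by
  rw [sec_mul_at act_a, sec_a, sec_bf, one_mul]

lemma ab4_mem : (ag * bg) ^ 4 ∈ Ei := by
  have hi : inactive ((ag * bg) ^ 2) := by rw [pow_two]; exact aa act_ab act_ab
  have e0 : sec ((ag * bg) ^ 2) false = ag⁻¹ := by
    rw [pow_two, sec_mul_af act_ab, sec_abf, sec_abt]; group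
  have e1 : sec ((ag * bg) ^ 2) true = bg⁻¹ * ag⁻¹ * bg := by
    rw [pow_two, sec_mul_at act_ab, sec_abf, sec_abt]
  rw [show (ag * bg) ^ 4 = ((ag * bg) ^ 2) ^ 2 by rw [← pow_mul]]
  refine Ei_up (pow_i hi _) ?_ ?_ <;> rw [sec_pow hi]
  · rw [e0, inv_pow]; exact Ei.inv_mem a2_mem
  · rw [e1]
    have := Ei_normal.conj_mem _ (Ei.inv_mem a2_mem) bg⁻¹
    convert this using 1
    rw [pow_two, pow_two]; group

/-- quotient by `E_∞` -/
abbrev Q := F ⧸ Ei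
/-- quotient map by `E_∞` -/
def qm : F →* Q := QuotientGroup.mk' Ei
lemma qm_one {g : F} : qm g = 1 ↔ g ∈ Ei := QuotientGroup.eq_one_iff g

lemma qa2 : qm ag * qm ag = 1 := by
  rw [← map_mul, ← pow_two]; exact qm_one.2 a2_mem
lemma qai : (qm ag)⁻¹ = qm ag := inv_eq_of_mul_eq_one_right qa2
lemma qab4 : (qm ag * qm bg) ^ 4 = 1 := by
  rw [← map_mul, ← map_pow]; exact qm_one.2 ab4_mem

/-- the commutation property -/
def Cq (x : Q) : Prop := Commute (qm bg ^ 4) (x⁻¹ * qm bg ^ 4 * x)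

lemma d4 : (qm bg⁻¹ * qm ag⁻¹) ^ 4 = 1 := by
  rw [map_inv, map_inv, ← mul_inv_rev, inv_pow, qab4, inv_one]

lemma comm_one_iff {x y : F} : comm x y ∈ Ei ↔ Commute (qm x) (qm y) := by
  rw [← qm_one, comm]
  simp only [map_mul, map_inv]
  rw [show (qm x)⁻¹ * (qm y)⁻¹ * qm x * qm y = (qm y * qm x)⁻¹ * (qm x * qm y) by group,
    inv_mul_eq_one]
  exact eq_comm

lemma Cq_iff (g : F) : Cq (qm g) ↔ comm (bg ^ 4) (g⁻¹ * bg ^ 4 * g) ∈ Ei := by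
  rw [comm_one_iff, Cq]; simp

lemma sec_comm {x y : F} (hx : inactive x) (hy : inactive y) (t : Bool) :
    sec (comm x y) t = comm (sec x t) (sec y t) := by
  unfold comm
  rw [sec_mul_i (ii (ii (inv_i hx) (inv_i hy)) hx), sec_mul_i (ii (inv_i hx) (inv_i hy)),
    sec_mul_i (inv_i hx), sec_inv_i hx, sec_inv_i hy]

lemma ina_comm {x y : F} (hx : inactive x) (hy : inactive y) : inactive (comm x y) :=
  ii (ii (ii (inv_i hx) (inv_i hy)) hx) hy

lemma d4' : qm ((bg⁻¹ * ag⁻¹) ^ 4) = 1 := by rw [map_pow, map_mul]; exact d4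

lemma Cq_act {g : F} (h : active g) : Cq (qm g) := by
  rw [Cq_iff]
  have hb := pow_i ina_b 4
  have hi : inactive (g⁻¹ * bg ^ 4 * g) := aa (ai (inv_a h) hb) h
  refine Ei_up (ina_comm hb hi) ?_ ?_ <;> rw [sec_comm hb hi, comm_one_iff]
  · rw [sec_pow ina_b, sec_bf, d4']; exact Commute.one_left _
  · rw [sec_mul_at (ai (inv_a h) hb), sec_mul_at (inv_a h), sec_inv_at h, sec_pow ina_b,
      sec_pow ina_b, sec_bf, map_mul, map_mul, d4', mul_one, map_inv, inv_mul_cancel]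
    exact Commute.one_right _

lemma Cq_ina {g : F} (h : inactive g) (h1 : Cq (qm (sec g true))) : Cq (qm g) := by
  rw [Cq_iff] at *
  have hb := pow_i ina_b 4
  have hi : inactive (g⁻¹ * bg ^ 4 * g) := ii (ii (inv_i h) hb) h
  refine Ei_up (ina_comm hb hi) ?_ ?_ <;> rw [sec_comm hb hi]
  · rw [comm_one_iff, sec_pow ina_b, sec_bf, d4']; exact Commute.one_left _
  · rw [sec_mul_i (ii (inv_i h) hb), sec_mul_i (inv_i h), sec_inv_i h, sec_pow ina_b, sec_bt]
    exact h1

/-- words with `n` letters `a` -/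
inductive A : ℕ → Q → Prop
  | base (k : ℤ) : A 0 (qm bg ^ k)
  | step {n : ℕ} {x : Q} (k : ℤ) : A n x → A (n + 1) (x * qm ag * qm bg ^ k)

/-- special words -/
inductive Asp : ℕ → Q → Prop
  | base (k : ℤ) : Asp 0 (qm bg ^ k)
  | step {n : ℕ} {x : Q} (k : ℤ) : Asp n x →
      Asp (n + 1) (x * qm ag * (qm bg)⁻¹ * qm ag * qm bg ^ k)

lemma A_b {n : ℕ} {x : Q} (h : A n x) (k : ℤ) : A n (x * qm bg ^ k) := by
  cases h with
  | base l => rw [← zpow_add]; exact A.base _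
  | step l h => rw [mul_assoc, ← zpow_add]; exact A.step _ h

lemma Asp_b {n : ℕ} {x : Q} (h : Asp n x) (k : ℤ) : Asp n (x * qm bg ^ k) := by
  cases h with
  | base l => rw [← zpow_add]; exact Asp.base _
  | step l h => rw [mul_assoc, ← zpow_add]; exact Asp.step _ h

lemma A_a {n : ℕ} {x : Q} (h : A n x) : A (n + 1) (x * qm ag) := by
  simpa using A.step 0 h

lemma Asp_A {n : ℕ} {x : Q} (h : Asp n x) : A (2 * n) x := by
  induction h with
  | base k => exact A.base k
  | @step n _ k _ ih =>
    rw [show 2 * (n + 1) = 2 * n + 1 + 1 by ring]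
    simpa using A.step k (A.step (-1) ih)

lemma A_all (x : Q) : ∃ n, A n x := by
  obtain ⟨g, rfl⟩ := QuotientGroup.mk'_surjective Ei x
  change ∃ n, A n (qm g)
  suffices H : ∀ y : Q, (∃ n, A n y) → ∃ n, A n (y * qm g) by
    simpa using H 1 ⟨0, by simpa using A.base 0⟩
  induction g using FreeGroup.induction_on with
  | C1 => intro y hy; simpa using hy
  | of x =>
    rintro y ⟨n, hn⟩
    cases x
    · exact ⟨_, A_a hn⟩
    · have := A_b hn 1
      rw [zpow_one] at this
      exact ⟨_, this⟩
  | inv_of x _ =>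
    rintro y ⟨n, hn⟩
    cases x
    · refine ⟨n + 1, ?_⟩
      have := A_a hn
      rw [← qai] at this
      rw [map_inv]; exact this
    · refine ⟨n, ?_⟩
      have := A_b hn (-1)
      rw [zpow_neg_one] at this
      rw [map_inv]; exact this
  | mul x y hx hy =>
    intro z hz
    rw [map_mul, ← mul_assoc]
    exact hy _ (hx _ hz)

lemma aba_i (k : ℤ) : inactive (ag * bg ^ k * ag) := aa (ai act_a (zpow_i ina_b k)) act_a
lemma aba_s (k : ℤ) : sec (ag * bg ^ k * ag) true = (bg⁻¹ * ag⁻¹) ^ k := by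
  rw [sec_mul_at (ai act_a (zpow_i ina_b k)), sec_mul_at act_a, sec_zpow ina_b, sec_a, sec_a,
    sec_bf]
  simp

lemma special {m : ℕ} {x : Q} (h : Asp m x) :
    ∃ g, qm g = x ∧ inactive g ∧ A m (qm (sec g true)) := by
  induction h with
  | base k =>
    refine ⟨bg ^ k, by simp, zpow_i ina_b k, ?_⟩
    rw [sec_zpow ina_b, sec_bt, map_zpow]; exact A.base k
  | @step n x k _ ih =>
    obtain ⟨g, rfl, hi, hA⟩ := ih
    refine ⟨g * (ag * bg ^ (-1 : ℤ) * ag) * bg ^ k, by simp [mul_assoc],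
      ii (ii hi (aba_i _)) (zpow_i ina_b k), ?_⟩
    rw [sec_mul_i (ii hi (aba_i _)), sec_mul_i hi, aba_s, sec_zpow ina_b, sec_bt]
    have := A.step (1 + k) hA
    convert this using 1
    simp [zpow_add, mul_assoc]

lemma general (m : ℕ) : ∀ x : Q, A (2 * m) x →
    ∃ g, qm g = x ∧ inactive g ∧
      ((∃ j, j < 2 * m ∧ A j (qm (sec g true))) ∨ Asp m (qm (sec g true))) := by
  induction m with
  | zero =>
    intro x h
    cases h with
    | base k =>
      refine ⟨bg ^ k, by simp, zpow_i ina_b k, Or.inr ?_⟩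
      rw [sec_zpow ina_b, sec_bt, map_zpow]; exact Asp.base k
  | succ m ih =>
    intro x h
    rw [show 2 * (m + 1) = 2 * m + 1 + 1 by ring] at h
    cases h with
    | step l h =>
    cases h with
    | @step _ y k h =>
    obtain ⟨g, rfl, hi, hA⟩ := ih _ h
    refine ⟨g * (ag * bg ^ k * ag) * bg ^ l, by simp [mul_assoc],
      ii (ii hi (aba_i _)) (zpow_i ina_b l), ?_⟩
    rw [sec_mul_i (ii hi (aba_i _)), sec_mul_i hi, aba_s, sec_zpow ina_b, sec_bt]
    simp only [map_mul, map_zpow]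
    generalize qm (sec g true) = y at hA
    have hj : ∃ j, j ≤ 2 * m ∧ A j y := by
      rcases hA with ⟨j, hj, h⟩ | h
      · exact ⟨j, hj.le, h⟩
      · exact ⟨_, le_rfl, Asp_A h⟩
    have hd : (qm bg⁻¹ * qm ag⁻¹) ^ k = (qm bg⁻¹ * qm ag⁻¹) ^ (k % 4) := by
      conv_lhs => rw [← Int.emod_add_mul_ediv k 4, zpow_add, zpow_mul]
      rw [show (qm bg⁻¹ * qm ag⁻¹) ^ (4 : ℤ) = 1 by exact_mod_cast d4]
      simp
    rw [hd]
    have h0 := Int.emod_nonneg k (show (4 : ℤ) ≠ 0 by norm_num)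
    have h4 := Int.emod_lt_of_pos k (show (0 : ℤ) < 4 by norm_num)
    generalize k % 4 = r at h0 h4
    obtain ⟨j, hjm, hj⟩ := hj
    interval_cases r
    · left
      refine ⟨j, by omega, ?_⟩
      simpa using A_b hj l
    · left
      refine ⟨j + 1, by omega, ?_⟩
      have := A.step l (A_b hj (-1))
      simpa [qai, mul_assoc] using this
    · have e : (qm bg⁻¹ * qm ag⁻¹) ^ (2 : ℤ) = (qm bg)⁻¹ * qm ag * (qm bg)⁻¹ * qm ag := by
        rw [map_inv, map_inv, qai, zpow_two]; group
      rw [e]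
      rcases hA with ⟨i, hi, h⟩ | h
      · left
        refine ⟨i + 1 + 1, by omega, ?_⟩
        have := A.step l (A.step (-1) (A_b h (-1)))
        simpa [mul_assoc] using this
      · right
        have := Asp.step l (Asp_b h (-1))
        simpa [mul_assoc] using this
    · left
      refine ⟨j + 1, by omega, ?_⟩
      have e : (qm bg⁻¹ * qm ag⁻¹) ^ (3 : ℤ) = qm ag * qm bg := by
        have h4 : (qm bg⁻¹ * qm ag⁻¹) ^ (3 : ℤ) * (qm bg⁻¹ * qm ag⁻¹) = 1 := by
          rw [← zpow_add_one]; exact_mod_cast d4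
        rw [eq_inv_of_mul_eq_one_left h4, map_inv, map_inv]; group
      rw [e]
      have := A.step (1 + l) hj
      simpa [zpow_add, mul_assoc] using this

lemma A_act {n : ℕ} {x : Q} (h : A n x) : ∃ g, qm g = x ∧
    (Even n → inactive g) ∧ (¬ Even n → active g) := by
  induction h with
  | base k => exact ⟨bg ^ k, by simp, fun _ => zpow_i ina_b k, fun h => absurd (by simp) h⟩
  | @step n x k _ ih =>
    obtain ⟨g, rfl, h1, h2⟩ := ih
    refine ⟨g * ag * bg ^ k, by simp, fun h => ?_, fun h => ?_⟩ <;> rw [Nat.even_add_one] at h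
    · exact ii (aa (h2 h) act_a) (zpow_i ina_b k)
    · exact ai (ia (h1 (not_not.1 h)) act_a) (zpow_i ina_b k)

lemma Cq_A (n : ℕ) : ∀ x : Q, A n x → Cq x := by
  induction n using Nat.strong_induction_on with
  | _ n ih =>
  intro x hx
  by_cases hn : Even n
  · obtain ⟨m, rfl⟩ := hn
    rw [← two_mul] at hx ih
    rcases Nat.eq_zero_or_pos m with rfl | hm
    · cases hx with
      | base k =>
        unfold Cq
        have : Commute (qm bg ^ 4) (qm bg ^ k) := (Commute.refl _).pow_left 4 |>.zpow_right k
        rw [mul_assoc, this.eq, inv_mul_cancel_left]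
    · obtain ⟨g, rfl, hi, ⟨j, hj, h⟩ | h⟩ := general m x hx
      · exact Cq_ina hi (ih j hj _ h)
      · apply Cq_ina hi
        obtain ⟨g', hg', hi', h'⟩ := special h
        rw [← hg']
        exact Cq_ina hi' (ih m (by omega) _ h')
  · obtain ⟨g, rfl, -, h⟩ := A_act hx
    exact Cq_act (h hn)

lemma N_le : NN ≤ Ei := by
  apply Subgroup.normalClosure_le_normal
  rintro x ((rfl | rfl) | ⟨w, rfl⟩)
  · exact a2_mem
  · exact ab4_mem
  · obtain ⟨n, hn⟩ := A_all (qm w)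
    exact (Cq_iff w).1 (Cq_A n _ hn)

end Obstr

namespace Obstr

/-! ### `E_∞ ⊆ N` -/

lemma pi_one {g : F} : pi g = 1 ↔ g ∈ NN := QuotientGroup.eq_one_iff g

lemma rel_mem {r : F} (h : r ∈ rels) : r ∈ NN := Subgroup.subset_normalClosure h

lemma na2 : ag ^ 2 ∈ NN := rel_mem (Or.inl (Or.inl rfl))
lemma nab4 : (ag * bg) ^ 4 ∈ NN := rel_mem (Or.inl (Or.inr rfl))
lemma ncomm (w : F) : comm (bg ^ 4) (w⁻¹ * bg ^ 4 * w) ∈ NN := rel_mem (Or.inr ⟨w, rfl⟩)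

lemma pa2 : pi ag * pi ag = 1 := by rw [← map_mul, ← pow_two]; exact pi_one.2 na2
lemma pai : (pi ag)⁻¹ = pi ag := inv_eq_of_mul_eq_one_right pa2
lemma pab4 : (pi ag * pi bg) ^ 4 = 1 := by
  rw [← map_mul, ← map_pow]; exact pi_one.2 nab4

lemma pcomm (w : Ghat) : Commute (pi bg ^ 4) (w * pi bg ^ 4 * w⁻¹) := by
  obtain ⟨w, rfl⟩ := QuotientGroup.mk'_surjective NN w
  change Commute (pi bg ^ 4) (pi w * pi bg ^ 4 * (pi w)⁻¹)
  have := pi_one.2 (ncomm w⁻¹)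
  rw [comm] at this
  simp only [map_mul, map_inv, map_pow, inv_inv] at this
  rw [mul_assoc, ← mul_inv_rev, inv_mul_eq_one] at this
  exact this.symm

lemma pcomm2 (u w : Ghat) : Commute (u * pi bg ^ 4 * u⁻¹) (w * pi bg ^ 4 * w⁻¹) := by
  have h := (pcomm (u⁻¹ * w)).map (MulAut.conj u).toMonoidHom
  simpa [mul_assoc] using h

/-- The normal closure of `b⁴` in `Ĝ`. -/
def RR : Subgroup Ghat := Subgroup.normalClosure {pi bg ^ 4}

instance : RR.Normal := Subgroup.normalClosure_normal

lemma RR_comm {x y : Ghat} (hx : x ∈ RR) (hy : y ∈ RR) : x * y = y * x := by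
  have key : ∀ x ∈ Group.conjugatesOfSet {pi bg ^ 4}, ∀ y ∈ Group.conjugatesOfSet {pi bg ^ 4},
      x * y = y * x := by
    intro x hx y hy
    obtain ⟨_, rfl, hx⟩ := Group.mem_conjugatesOfSet_iff.1 hx
    obtain ⟨_, rfl, hy⟩ := Group.mem_conjugatesOfSet_iff.1 hy
    obtain ⟨u, rfl⟩ := isConj_iff.1 hx
    obtain ⟨v, rfl⟩ := isConj_iff.1 hy
    exact pcomm2 u v
  refine Subgroup.closure_induction₂ (p := fun x y _ _ => Commute x y) (fun x y hx hy => key x hx y hy)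
    ?_ ?_ ?_ ?_ ?_ ?_ hx hy
  · intros; exact Commute.one_left _
  · intros; exact Commute.one_right _
  · intro x y z _ _ _ h1 h2; exact h1.mul_left h2
  · intro x y z _ _ _ h1 h2; exact h1.mul_right h2
  · intro x y _ _ h; exact h.inv_left
  · intro x y _ _ h; exact h.inv_right

instance instRR : CommGroup RR :=
  { (inferInstance : Group RR) with
    mul_comm := fun x y => Subtype.ext (RR_comm x.2 y.2) }

/-- conjugation action -/
def cj : F →* MulAut RR := MulAut.conjNormal.comp pi

lemma cj_apply (w : F) (x : RR) : (cj w x : Ghat) = pi w * x * (pi w)⁻¹ :=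
  MulAut.conjNormal_apply _ _

/-- basic element -/
def e0 : RR := ⟨pi bg ^ 4, Subgroup.subset_normalClosure rfl⟩

lemma cj_N {g : F} (h : g ∈ NN) : cj g = 1 := by
  rw [cj, MonoidHom.comp_apply, pi_one.2 h, map_one]

lemma cj_a2 : cj ag * cj ag = 1 := by rw [← map_mul, ← pow_two]; exact cj_N na2
lemma cj_ab4 : (cj ag * cj bg) ^ 4 = 1 := by rw [← map_mul, ← map_pow]; exact cj_N nab4
lemma cj_b4 : cj bg ^ 4 = 1 := by
  rw [← map_pow]
  ext x
  rw [cj_apply, map_pow]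
  have := RR_comm e0.2 x.2
  change pi bg ^ 4 * _ = _ * pi bg ^ 4 at this
  rw [this]; simp
lemma cj_b0 : cj bg e0 = e0 := by
  apply Subtype.ext
  rw [cj_apply]
  change pi bg * pi bg ^ 4 * _ = pi bg ^ 4
  rw [← pow_succ', pow_succ]; simp

section abstract_group
variable {G : Type*} [Group G] {x y : G}

lemma abs_xi (h1 : x * x = 1) : x⁻¹ = x := inv_eq_of_mul_eq_one_right h1
lemma abs_yi (h2 : y ^ 4 = 1) : (y * y)⁻¹ = y * y := by
  apply inv_eq_of_mul_eq_one_right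
  rw [← h2]; simp [pow_succ, mul_assoc]

lemma abs_yS : SemiconjBy y (x * (y * y)) (y * x * y) := by
  unfold SemiconjBy; simp [mul_assoc]
lemma abs_yT (h1 : x * x = 1) (h2 : y ^ 4 = 1) :
    SemiconjBy y (y * x * y) (x * (y * y))⁻¹ := by
  unfold SemiconjBy
  rw [mul_inv_rev (x), abs_yi h2, abs_xi h1]; simp [mul_assoc]
lemma abs_xS (h1 : x * x = 1) (h2 : y ^ 4 = 1) :
    SemiconjBy x (x * (y * y)) (x * (y * y))⁻¹ := by
  unfold SemiconjBy
  rw [mul_inv_rev (x), abs_yi h2, abs_xi h1, ← mul_assoc, h1, mul_assoc, h1]; simp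
lemma abs_ab (h3 : (x * y) ^ 4 = 1) : x * y * (x * y) = (x * y * (x * y))⁻¹ := by
  symm
  apply inv_eq_of_mul_eq_one_right
  rw [← h3]; simp [pow_succ, mul_assoc]
lemma abs_xT (h1 : x * x = 1) (h3 : (x * y) ^ 4 = 1) :
    SemiconjBy x (y * x * y) (y * x * y)⁻¹ := by
  unfold SemiconjBy
  have := abs_ab h3
  calc x * (y * x * y) = x * y * (x * y) := by simp [mul_assoc]
    _ = (y * x * y)⁻¹ * x⁻¹ := by rw [this]; group
    _ = _ := by rw [abs_xi h1]
lemma abs_ST (h1 : x * x = 1) (h2 : y ^ 4 = 1) (h3 : (x * y) ^ 4 = 1) :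
    Commute (x * (y * y)) (y * x * y) := by
  have h : SemiconjBy (x * (y * y)) (y * x * y) ((y * x * y)⁻¹)⁻¹ := by
    refine (abs_xT h1 h3).inv_right.mul_left ?_
    have := (abs_yT h1 h2)
    refine SemiconjBy.mul_left ?_ this
    exact abs_yS.inv_right
  rw [inv_inv] at h
  exact h
end abstract_group

/-- translation `S` -/
def SS : MulAut RR := cj ag * (cj bg * cj bg)
/-- translation `T` -/
def TT : MulAut RR := cj bg * cj ag * cj bg

/-- basis elements -/
def ee (p : ℤ × ℤ) : RR := (SS ^ p.1 * TT ^ p.2) e0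

/-- half turn about `(1/2,0)` -/
def pA : Equiv.Perm (ℤ × ℤ) where
  toFun p := (1 - p.1, -p.2)
  invFun p := (1 - p.1, -p.2)
  left_inv p := by ext <;> simp
  right_inv p := by ext <;> simp

/-- quarter turn about `0` -/
def pB : Equiv.Perm (ℤ × ℤ) where
  toFun p := (-p.2, p.1)
  invFun p := (p.2, -p.1)
  left_inv p := by ext <;> simp
  right_inv p := by ext <;> simp

lemma cj_b_ee (p : ℤ × ℤ) : cj bg (ee p) = ee (pB p) := by
  have h1 : cj bg * (SS ^ p.1 * TT ^ p.2) = TT ^ p.1 * (SS⁻¹) ^ p.2 * cj bg :=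
    ((abs_yS (x := cj ag) (y := cj bg)).zpow_right p.1).mul_right
      ((abs_yT cj_a2 cj_b4).zpow_right p.2)
  have h2 : TT ^ p.1 * (SS⁻¹) ^ p.2 = SS ^ (-p.2) * TT ^ p.1 := by
    rw [inv_zpow']
    exact ((abs_ST cj_a2 cj_b4 cj_ab4).zpow_zpow (-p.2) p.1).symm
  rw [ee, ← MulAut.mul_apply, h1, h2, MulAut.mul_apply, cj_b0]
  rfl

lemma cj_a_e0 : cj ag e0 = SS e0 := by
  rw [SS, MulAut.mul_apply, MulAut.mul_apply, cj_b0, cj_b0]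

lemma cj_a_ee (p : ℤ × ℤ) : cj ag (ee p) = ee (pA p) := by
  have h1 : cj ag * (SS ^ p.1 * TT ^ p.2) = (SS⁻¹) ^ p.1 * (TT⁻¹) ^ p.2 * cj ag :=
    ((abs_xS cj_a2 cj_b4).zpow_right p.1).mul_right ((abs_xT cj_a2 cj_ab4).zpow_right p.2)
  have h2 : (SS⁻¹) ^ p.1 * (TT⁻¹) ^ p.2 * SS = SS ^ (1 - p.1) * TT ^ (-p.2) := by
    have hc : Commute SS (TT ^ (-p.2)) := (abs_ST cj_a2 cj_b4 cj_ab4).zpow_right (-p.2)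
    rw [inv_zpow', inv_zpow', mul_assoc, ← hc.eq,
      ← mul_assoc, ← zpow_add_one]
    congr 2; ring
  rw [ee, ← MulAut.mul_apply, h1, MulAut.mul_apply, cj_a_e0, ← MulAut.mul_apply, h2]
  rfl

/-- the cut function -/
def vv (p : ℤ × ℤ) : ℤ := if p.2 = 0 then (if p.1 ≤ 0 then 1 else -1) else 0

/-- functions on the lattice, with motions -/
abbrev WW := (ℤ × ℤ → Multiplicative ℤ) ⋊[permAut (ℤ × ℤ) (Multiplicative ℤ)]
  Equiv.Perm (ℤ × ℤ)

/-- winding cocycle -/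
def Psi : F →* WW := FreeGroup.lift fun x =>
  if x then ⟨fun p => Multiplicative.ofAdd (vv p), pB⟩
  else ⟨fun p => Multiplicative.ofAdd (vv p), pA⟩

lemma Psi_a : Psi ag = ⟨fun p => Multiplicative.ofAdd (vv p), pA⟩ := by simp [Psi, ag]
lemma Psi_b : Psi bg = ⟨fun p => Multiplicative.ofAdd (vv p), pB⟩ := by simp [Psi, bg]

lemma pA_inv (p : ℤ × ℤ) : pA⁻¹ p = (1 - p.1, -p.2) := rfl
lemma pB_inv (p : ℤ × ℤ) : pB⁻¹ p = (p.2, -p.1) := rfl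
lemma pA_app (p : ℤ × ℤ) : pA p = (1 - p.1, -p.2) := rfl
lemma pB_app (p : ℤ × ℤ) : pB p = (-p.2, p.1) := rfl

/-- pure function element -/
def fe (f : ℤ × ℤ → ℤ) : WW := ⟨fun p => Multiplicative.ofAdd (f p), 1⟩

lemma fe_inj {f g : ℤ × ℤ → ℤ} (h : fe f = fe g) : f = g := by
  have := congrArg SemidirectProduct.left h
  funext p
  exact Multiplicative.ofAdd.injective (congrFun this p)

lemma fe_zero : fe 0 = 1 := rfl
lemma fe_mul (f g : ℤ × ℤ → ℤ) : fe f * fe g = fe (f + g) := by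
  apply SemidirectProduct.ext
  · funext p; rfl
  · rfl
lemma fe_inv (f : ℤ × ℤ → ℤ) : (fe f)⁻¹ = fe (-f) := by
  rw [inv_eq_iff_mul_eq_one, fe_mul, add_neg_cancel, fe_zero]

lemma fe_conj (w : WW) (f : ℤ × ℤ → ℤ) : w * fe f * w⁻¹ = fe (fun p => f (w.right⁻¹ p)) := by
  rw [mul_inv_eq_iff_eq_mul]
  apply SemidirectProduct.ext
  · funext p
    simp only [SemidirectProduct.mul_left, Pi.mul_apply, permAut_apply, fe]
    rw [mul_comm]; rfl
  · simp [fe]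

lemma vv_A (p : ℤ × ℤ) : vv p + vv (1 - p.1, -p.2) = 0 := by
  unfold vv; simp only [neg_eq_zero]; split_ifs <;> omega

lemma Psi_a2 : Psi (ag ^ 2) = 1 := by
  rw [map_pow, Psi_a, pow_two]
  apply SemidirectProduct.ext
  · funext p; exact congrArg Multiplicative.ofAdd (vv_A p)
  · ext p <;> simp [pA_app]

lemma Psi_ab : Psi (ag * bg) = ⟨1, pA * pB⟩ := by
  rw [map_mul, Psi_a, Psi_b]
  apply SemidirectProduct.ext
  · funext p; exact congrArg Multiplicative.ofAdd (vv_A p)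
  · rfl

lemma Psi_ab4 : Psi ((ag * bg) ^ 4) = 1 := by
  rw [map_pow, Psi_ab]
  simp only [pow_succ, pow_zero, one_mul]
  apply SemidirectProduct.ext
  · funext p; simp
  · ext p <;> simp [pA_app, pB_app]

/-- delta function times four -/
def dl (q p : ℤ × ℤ) : ℤ := 4 * Finsupp.single q 1 p

lemma Psi_b4 : Psi (bg ^ 4) = fe (dl 0) := by
  rw [map_pow, Psi_b]
  simp only [pow_succ, pow_zero, one_mul]
  apply SemidirectProduct.ext
  · funext p
    have : vv p + vv (p.2, -p.1) + vv (-p.1, -p.2) + vv (-p.2, p.1) = dl 0 p := by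
      obtain ⟨m, n⟩ := p
      unfold vv dl
      rw [Finsupp.single_apply]
      simp only [neg_eq_zero, Prod.ext_iff, Prod.fst_zero, Prod.snd_zero]
      split_ifs <;> omega
    simp only [fe]
    rw [← this]
    simp [permAut_apply, pB_inv, mul_assoc]
  · ext p <;> simp [pB_app, fe]

lemma perm_ai (s : Equiv.Perm (ℤ × ℤ)) (p : ℤ × ℤ) : s (s⁻¹ p) = p := s.apply_symm_apply p
lemma perm_ia (s : Equiv.Perm (ℤ × ℤ)) (p : ℤ × ℤ) : s⁻¹ (s p) = p := s.symm_apply_apply p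

lemma Psi_conj (w : F) : Psi (w * bg ^ 4 * w⁻¹) = fe (dl ((Psi w).right 0)) := by
  rw [map_mul, map_mul, map_inv, Psi_b4, fe_conj]
  congr 1
  funext p
  unfold dl
  rw [Finsupp.single_apply, Finsupp.single_apply]
  congr 2
  exact propext (Equiv.eq_symm_apply _)

lemma N_Psi {g : F} (h : g ∈ NN) : Psi g = 1 := by
  suffices NN ≤ Psi.ker from this h
  apply Subgroup.normalClosure_le_normal
  rintro x ((rfl | rfl) | ⟨w, rfl⟩)
  · exact Psi_a2
  · exact Psi_ab4
  · change Psi _ = 1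
    have h := Psi_conj w⁻¹
    rw [inv_inv] at h
    unfold comm
    rw [map_mul, map_mul, map_mul, map_inv, map_inv, h, Psi_b4, fe_inv, fe_inv, fe_mul, fe_mul,
      fe_mul, ← fe_zero]
    congr 1; abel

lemma cj_ee (w : F) : ∀ p, cj w (ee p) = ee ((Psi w).right p) := by
  have inv_lemma : ∀ w : F, (∀ p, cj w (ee p) = ee ((Psi w).right p)) →
      ∀ p, cj w⁻¹ (ee p) = ee ((Psi w⁻¹).right p) := by
    intro w h p
    have := h ((Psi w⁻¹).right p)
    rw [map_inv, SemidirectProduct.inv_right, perm_ai] at this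
    rw [map_inv, map_inv, SemidirectProduct.inv_right, ← this, MulAut.inv_apply_self]
  induction w using FreeGroup.induction_on with
  | C1 => intro p; simp
  | of x =>
    intro p
    cases x
    · change cj ag _ = ee ((Psi ag).right p)
      rw [Psi_a]; exact cj_a_ee p
    · change cj bg _ = ee ((Psi bg).right p)
      rw [Psi_b]; exact cj_b_ee p
  | inv_of x h => exact inv_lemma _ h
  | mul x y hx hy =>
    intro p
    rw [map_mul, MulAut.mul_apply, hy, hx, map_mul]; rfl

lemma ee_zero : ee 0 = e0 := by simp [ee]

lemma pi_conj (w : F) : pi (w * bg ^ 4 * w⁻¹) = (ee ((Psi w).right 0) : Ghat) := by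
  rw [← cj_ee, cj_apply, ee_zero]; simp [e0]

/-- The combination of basis elements. -/
def lam (f : ℤ × ℤ →₀ ℤ) : RR := f.prod fun p k => ee p ^ k

lemma lam_add (f g : ℤ × ℤ →₀ ℤ) : lam (f + g) = lam f * lam g :=
  Finsupp.prod_add_index' (fun p => zpow_zero _) (fun p k l => zpow_add _ _ _)
lemma lam_zero : lam 0 = 1 := Finsupp.prod_zero_index
lemma lam_neg (f : ℤ × ℤ →₀ ℤ) : lam (-f) = (lam f)⁻¹ := by
  rw [eq_inv_iff_mul_eq_one, ← lam_add, neg_add_cancel, lam_zero]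
lemma lam_single (p : ℤ × ℤ) : lam (Finsupp.single p 1) = ee p := by
  simp [lam]

/-- Elements of `N·M₁`, described by even finitely supported functions. -/
def LL : Subgroup F where
  carrier := {g | ∃ f : ℤ × ℤ →₀ ℤ, (∀ p, f p ≠ 0 → Even (p.1 + p.2)) ∧
    Psi g = fe (fun p => 4 * f p) ∧ pi g = lam f}
  mul_mem' := by
    rintro g h ⟨f, f1, f2, f3⟩ ⟨k, k1, k2, k3⟩
    refine ⟨f + k, ?_, ?_, ?_⟩
    · intro p hp
      by_cases h : f p = 0
      · exact k1 p fun h' => hp (by simp [h, h'])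
      · exact f1 p h
    · rw [map_mul, f2, k2, fe_mul]; congr 1; funext p; simp [mul_add]
    · rw [map_mul, f3, k3, lam_add]; rfl
  one_mem' := ⟨0, by simp, by rw [map_one, ← fe_zero]; congr 1, by rw [lam_zero, map_one]; rfl⟩
  inv_mem' := by
    rintro g ⟨f, f1, f2, f3⟩
    refine ⟨-f, ?_, ?_, ?_⟩
    · intro p hp; exact f1 p (by simpa using hp)
    · rw [map_inv, f2, fe_inv]; congr 1; funext p; simp
    · rw [map_inv, f3, lam_neg]; rfl

lemma N_LL : NN ≤ LL := by
  intro g hg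
  refine ⟨0, by simp, ?_, ?_⟩
  · rw [N_Psi hg, ← fe_zero]; congr 1
  · rw [pi_one.2 hg, lam_zero]; rfl

lemma conj_LL (w : F) (h : Even (((Psi w).right 0).1 + ((Psi w).right 0).2)) :
    w * bg ^ 4 * w⁻¹ ∈ LL := by
  refine ⟨Finsupp.single ((Psi w).right 0) 1, ?_, ?_, ?_⟩
  · intro p hp
    rw [Finsupp.single_apply] at hp
    have : (Psi w).right 0 = p := by by_contra hh; simp [hh] at hp
    rw [← this]; exact h
  · exact Psi_conj w
  · rw [lam_single]; exact pi_conj w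

/-- A section of `g ↦ g|₀`. -/
def th : F →* F := FreeGroup.lift fun x =>
  if x then ag * bg * ag⁻¹ else bg⁻¹ * (ag * bg * ag⁻¹)⁻¹

lemma th_a : th ag = bg⁻¹ * (ag * bg * ag⁻¹)⁻¹ := by simp [th, ag]
lemma th_b : th bg = ag * bg * ag⁻¹ := by simp [th, bg]

/-- parity preserving permutations -/
def PP : Subgroup (Equiv.Perm (ℤ × ℤ)) where
  carrier := {s | ∀ p : ℤ × ℤ, Even ((s p).1 + (s p).2) ↔ Even (p.1 + p.2)}
  mul_mem' := by
    intro s t hs ht p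
    exact (hs (t p)).trans (ht p)
  one_mem' := fun p => Iff.rfl
  inv_mem' := by
    intro s hs p
    have := hs (s⁻¹ p)
    rw [perm_ai] at this
    exact this.symm

lemma pB_PP : pB ∈ PP := by
  intro p; rw [pB_app]; simp only [Int.even_iff]; omega

lemma pAB_PP : pA * pB * pA⁻¹ ∈ PP := by
  intro p
  rw [Equiv.Perm.mul_apply, Equiv.Perm.mul_apply, pA_inv, pB_app, pA_app]
  simp only [Int.even_iff]; omega

lemma th_PP (w : F) : (Psi (th w)).right ∈ PP := by
  have hb : (Psi (th bg)).right ∈ PP := by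
    rw [th_b]; simp only [map_mul, map_inv, Psi_a, Psi_b]; exact pAB_PP
  have ha : (Psi (th ag)).right ∈ PP := by
    have h : th ag = bg⁻¹ * (th bg)⁻¹ := by rw [th_a, th_b]
    rw [h, map_mul, map_inv, map_inv, SemidirectProduct.mul_right, SemidirectProduct.inv_right,
      SemidirectProduct.inv_right]
    refine PP.mul_mem (PP.inv_mem ?_) (PP.inv_mem hb)
    rw [Psi_b]; exact pB_PP
  induction w using FreeGroup.induction_on with
  | C1 => simp [PP.one_mem]
  | of x => cases x; exacts [ha, hb]
  | inv_of x h => rw [map_inv, map_inv, SemidirectProduct.inv_right]; exact PP.inv_mem h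
  | mul x y hx hy => rw [map_mul, map_mul, SemidirectProduct.mul_right]; exact PP.mul_mem hx hy

lemma th_ab : th (ag * bg) = bg⁻¹ := by rw [map_mul, th_a, th_b, inv_mul_cancel_right]

lemma NN_n : NN.Normal := inferInstance

lemma th_a2 : th (ag ^ 2) ∈ NN := by
  rw [← pi_one, map_pow, th_a]
  simp only [map_pow, map_mul, map_inv, pai]
  have h := abs_ab pab4
  rw [← mul_inv_rev, inv_pow, inv_eq_one, pow_two]
  calc pi ag * pi bg * pi ag * pi bg * (pi ag * pi bg * pi ag * pi bg)
      = (pi ag * pi bg) ^ 4 := by simp [pow_succ, mul_assoc]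
    _ = 1 := pab4

lemma th_N {g : F} (hg : g ∈ NN) : th g ∈ LL := by
  suffices NN ≤ LL.comap th from this hg
  refine (Subgroup.closure_le _).2 ?_
  intro x hx
  obtain ⟨r, hr, hx⟩ := Group.mem_conjugatesOfSet_iff.1 hx
  obtain ⟨u, rfl⟩ := isConj_iff.1 hx
  change th (u * r * u⁻¹) ∈ LL
  rw [map_mul, map_mul, map_inv]
  rcases hr with (rfl | rfl) | ⟨w, rfl⟩
  · exact N_LL (NN_n.conj_mem _ th_a2 _)
  · have : th ((ag * bg) ^ 4) = (bg ^ 4)⁻¹ := by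
      rw [map_pow, th_ab, inv_pow]
    rw [this, ← conj_inv]
    apply LL.inv_mem
    apply conj_LL
    have := th_PP u 0
    rw [this]; simp
  · apply N_LL
    apply NN_n.conj_mem
    have h : th (comm (bg ^ 4) (w⁻¹ * bg ^ 4 * w)) =
        ag * comm (bg ^ 4) ((ag⁻¹ * th w * ag)⁻¹ * bg ^ 4 * (ag⁻¹ * th w * ag)) * ag⁻¹ := by
      unfold comm
      simp only [map_mul, map_inv, map_pow, th_b, conj_pow]
      group
    rw [h]
    exact NN_n.conj_mem _ (ncomm _) _

/-- reconstruction property -/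
def Rc (h : F) : Prop := (inactive h ∧ pi h = pi (th (sec h false))) ∨
  (active h ∧ pi h = pi (th (sec h false)) * pi ag)

lemma sec_bif : sec bg⁻¹ false = ag * bg := by rw [sec_inv_i ina_b, sec_bf]; group
lemma sec_bit : sec bg⁻¹ true = bg⁻¹ := by rw [sec_inv_i ina_b, sec_bt]

lemma th_baI : th (bg⁻¹ * ag⁻¹) = bg := by rw [← mul_inv_rev, map_inv, th_ab, inv_inv]

lemma Rc_all (h : F) : ∀ g, Rc g → Rc (g * h) := by
  induction h using FreeGroup.induction_on with
  | C1 => intro g hg; simpa using hg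
  | of x =>
    cases x
    · change ∀ g, Rc g → Rc (g * ag)
      rintro g (⟨h1, h2⟩ | ⟨h1, h2⟩)
      · refine Or.inr ⟨ia h1 act_a, ?_⟩
        rw [sec_mul_i h1, sec_a, mul_one, map_mul, h2]
      · refine Or.inl ⟨aa h1 act_a, ?_⟩
        rw [sec_mul_af h1, sec_a, mul_one, map_mul, h2, mul_assoc, pa2, mul_one]
    · change ∀ g, Rc g → Rc (g * bg)
      rintro g (⟨h1, h2⟩ | ⟨h1, h2⟩)
      · refine Or.inl ⟨ii h1 ina_b, ?_⟩
        rw [sec_mul_i h1, sec_bf, map_mul, h2, map_mul, map_mul, th_baI]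
      · refine Or.inr ⟨ai h1 ina_b, ?_⟩
        rw [sec_mul_af h1, sec_bt, map_mul, h2, map_mul, map_mul, th_b]
        simp [mul_assoc]
  | inv_of x _ =>
    cases x
    · change ∀ g, Rc g → Rc (g * ag⁻¹)
      have s0 : ∀ x, sec ag⁻¹ x = 1 := by
        intro x; cases x
        · rw [sec_inv_af act_a, sec_a, inv_one]
        · rw [sec_inv_at act_a, sec_a, inv_one]
      rintro g (⟨h1, h2⟩ | ⟨h1, h2⟩)
      · refine Or.inr ⟨ia h1 (inv_a act_a), ?_⟩
        rw [sec_mul_i h1, s0, mul_one, map_mul, h2, map_inv, pai]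
      · refine Or.inl ⟨aa h1 (inv_a act_a), ?_⟩
        rw [sec_mul_af h1, s0, mul_one, map_mul, h2, map_inv, mul_inv_cancel_right]
    · change ∀ g, Rc g → Rc (g * bg⁻¹)
      rintro g (⟨h1, h2⟩ | ⟨h1, h2⟩)
      · refine Or.inl ⟨ii h1 (inv_i ina_b), ?_⟩
        rw [sec_mul_i h1, sec_bif, map_mul, h2, map_mul, map_mul, th_ab]
      · refine Or.inr ⟨ai h1 (inv_i ina_b), ?_⟩
        rw [sec_mul_af h1, sec_bit, map_mul, h2, map_mul, map_mul, map_inv th, th_b]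
        simp [mul_assoc]
  | mul x y hx hy =>
    intro g hg
    rw [← mul_assoc]
    exact hy _ (hx _ hg)

lemma recon {h : F} (hi : inactive h) : pi h = pi (th (sec h false)) := by
  have : Rc h := by
    have := Rc_all h 1 (Or.inl ⟨inactive_one, by rw [sec_one, map_one, map_one, map_one]⟩)
    rwa [one_mul] at this
  rcases this with ⟨_, h2⟩ | ⟨h1, _⟩
  · exact h2
  · exact (not_both hi h1).elim

lemma mem_LL {h : F} (hi : inactive h) (hs : sec h false ∈ NN) : h ∈ LL := by
  have h1 : h * (th (sec h false))⁻¹ ∈ NN := by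
    rw [← pi_one, map_mul, map_inv, ← recon hi, mul_inv_cancel]
  have := LL.mul_mem (N_LL h1) (th_N hs)
  simpa using this

lemma Up_N : Up NN ≤ NN := by
  rintro g ⟨hi, h0, h1⟩
  obtain ⟨f, f1, f2, f3⟩ := mem_LL hi h0
  have h' : ag * g * ag⁻¹ ∈ LL := by
    refine mem_LL (aa (ai act_a hi) (inv_a act_a)) ?_
    rw [sec_mul_af (ai act_a hi), sec_mul_af act_a, sec_inv_at act_a, sec_a]
    simpa using h1
  obtain ⟨k, k1, k2, -⟩ := h'
  rw [map_mul, map_mul, map_inv, f2, fe_conj, Psi_a] at k2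
  have hk := fe_inj k2
  have hf : f = 0 := by
    ext p
    by_contra hp
    have e1 := f1 p hp
    have e2 := congrFun hk (pA p)
    simp only [perm_ia] at e2
    have e3 : k (pA p) ≠ 0 := by
      intro h; rw [h] at e2; apply hp; rw [Finsupp.coe_zero, Pi.zero_apply]; omega
    have e4 := k1 _ e3
    rw [pA_app] at e4
    simp only [Int.even_iff] at e1 e4
    omega
  rw [← pi_one, f3, hf, lam_zero]; rfl

lemma Es_le (n : ℕ) : Es n ≤ NN := by
  induction n with
  | zero => exact bot_le
  | succ n ih => exact fun g hg => Up_N ⟨hg.1, ih hg.2.1, ih hg.2.2⟩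

lemma Ei_eq : Ei = NN := le_antisymm (iSup_le Es_le) N_le

end Obstr

open Obstr in
theorem stmt12 : (⋃ n : ℕ, E n) = (NN : Set F) := by
  rw [Ei_coe, Ei_eq]
end
end
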